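/- arXiv:2407.08953 — 14 statements merged into one kernel-verified Lean document; each statement's English description precedes it below -/
import Mathlib

section
/- Baseline Shapley preserves average individual monotonicity: if f : (Fin n → ℝ) → ℝ is individually monotonic (increasing) in coordinate α, and the explicand x̄ and baseline x' satisfy x'_α ≤ x̄_α, then the Baseline Shapley attribution of coordinate α is nonnegative: BS_α(x̄, x', f) ≥ 0. -/
open Finset

/-- Baseline Shapley attribution: `v(S) = f(x̄_S ; x'_{N∖S})`. -/
noncomputable def BShap {n : ℕ} (xbar x' : Fin n → ℝ) (f : (Fin n → ℝ) → ℝ) (i : Fin n) : ℝ :=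
  ∑ S ∈ (Finset.univ.erase i).powerset,
    ((S.card.factorial * (n - S.card - 1).factorial : ℝ) / (n.factorial : ℝ)) *
      (f (fun j => if j ∈ insert i S then xbar j else x' j) -
       f (fun j => if j ∈ S then xbar j else x' j))

/-- Baseline Shapley preserves average individual monotonicity. -/
theorem bshap_average_individual_monotonicity {n : ℕ}
    (f : (Fin n → ℝ) → ℝ) (α : Fin n)
    (hmono : ∀ (x : Fin n → ℝ) (v : ℝ), x α ≤ v → f x ≤ f (Function.update x α v))
    (xbar x' : Fin n → ℝ) (hx : x' α ≤ xbar α) :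
    0 ≤ BShap xbar x' f α := by
  refine Finset.sum_nonneg fun S hS => mul_nonneg (by positivity) (sub_nonneg.2 ?_)
  have hα : α ∉ S := fun h => Finset.notMem_erase α _ (Finset.mem_powerset.1 hS h)
  have hupdate : (fun j => if j ∈ insert α S then xbar j else x' j) =
      Function.update (fun j => if j ∈ S then xbar j else x' j) α (xbar α) := by
    ext j
    by_cases hj : j = α
    · subst hj
      simp
    · simp [hj]
  rw [hupdate]
  exact hmono _ _ (by simpa [hα] using hx)
end

section
/- Baseline Shapley preserves demand individual monotonicity: if f : (Fin n → ℝ) → ℝ is individually monotonic (increasing) in coordinate α, x̄ is an explicand, x' a baseline with x'_α ≤ x̄_α, and x* = update x̄ α (x̄_α + c) for some c > 0, then BS_α(x*, x', f) ≥ BS_α(x̄, x', f). -/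
open Finset

/-- Baseline Shapley preserves demand individual monotonicity. -/
theorem bshap_demand_individual_monotonicity {n : ℕ}
    (f : (Fin n → ℝ) → ℝ) (α : Fin n)
    (hmono : ∀ (x : Fin n → ℝ) (v : ℝ), x α ≤ v → f x ≤ f (Function.update x α v))
    (xbar x' : Fin n → ℝ) (hx : x' α ≤ xbar α)
    (c : ℝ) (hc : 0 < c)
    (xstar : Fin n → ℝ) (hstar : xstar = Function.update xbar α (xbar α + c)) :
    BShap xbar x' f α ≤ BShap xstar x' f α := by
  subst hstar
  unfold BShap
  refine Finset.sum_le_sum fun S hS => ?_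
  have hα : α ∉ S := fun h => Finset.notMem_erase α _ (Finset.mem_powerset.mp hS h)
  refine mul_le_mul_of_nonneg_left (sub_le_sub ?_ (le_of_eq ?_)) (by positivity)
  · refine (hmono _ (xbar α + c) (by simpa using hc.le)).trans_eq ?_
    congr 1
    funext j
    rcases eq_or_ne j α with rfl | hj
    · simp
    · simp [hj]
  · congr 1
    funext j
    rcases eq_or_ne j α with rfl | hj
    · simp [hα]
    · simp [hj]
end

section
/- Baseline Shapley preserves the diminishing marginal axiom: let f : (Fin n → ℝ) → ℝ be smooth with ∂f/∂x_α ≥ 0 and ∂²f/∂x_α² ≤ 0 everywhere (diminishing marginal effect in coordinate α). Then for any baseline x', any vector of other coordinates x̄_{¬α}, and any two values x̄_α ≥ x*_α > x'_α, one has BS_α((x̄_α, x̄_{¬α}), x', f) / (x̄_α − x'_α) ≤ BS_α((x*_α, x̄_{¬α}), x', f) / (x*_α − x'_α), where (v, x̄_{¬α}) denotes the explicand whose α-coordinate is v and whose other coordinates are x̄_{¬α}. -/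
open Finset

/-- A smooth function whose second partial derivative in coordinate `i` is nonpositive is concave
along every line parallel to the `i`-th axis. -/
theorem concaveOn_comp_update {ι : Type*} [Fintype ι] [DecidableEq ι] {f : (ι → ℝ) → ℝ} {i : ι}
    (hf : ContDiff ℝ 2 f)
    (hd2 : ∀ x : ι → ℝ,
      fderiv ℝ (fun y => fderiv ℝ f y (Pi.single i 1)) x (Pi.single i 1) ≤ 0)
    (z : ι → ℝ) : ConcaveOn ℝ Set.univ (fun t => f (Function.update z i t)) := by
  have key : ∀ h : (ι → ℝ) → ℝ, Differentiable ℝ h → ∀ t : ℝ,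
      HasDerivAt (fun t => h (Function.update z i t))
        (fderiv ℝ h (Function.update z i t) (Pi.single i 1)) t := fun h hh t =>
    (hh (Function.update z i t)).hasFDerivAt.comp_hasDerivAt t (hasDerivAt_update z i t)
  have hf' : Differentiable ℝ fun y => fderiv ℝ f y (Pi.single i 1) :=
    ((hf.fderiv_right (m := 1) (by norm_num)).differentiable (by norm_num)).clm_apply
      (differentiable_const _)
  have hdf := key f (hf.differentiable (by norm_num))
  have hdf' := key _ hf'
  refine Antitone.concaveOn_univ_of_deriv (fun t => (hdf t).differentiableAt) ?_
  rw [show deriv (fun t => f (Function.update z i t)) =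
    fun t => fderiv ℝ f (Function.update z i t) (Pi.single i 1) from funext fun t => (hdf t).deriv]
  exact antitone_of_deriv_nonpos (fun t => (hdf' t).differentiableAt)
    fun t => (hdf' t).deriv.trans_le (hd2 _)

/-- Baseline Shapley preserves the diminishing marginal axiom. -/
theorem bshap_diminishing_marginal {n : ℕ}
    (f : (Fin n → ℝ) → ℝ) (α : Fin n)
    (hsmooth : ContDiff ℝ (⊤ : ℕ∞) f)
    (hd1 : ∀ x : Fin n → ℝ, 0 ≤ fderiv ℝ f x (Pi.single α 1))
    (hd2 : ∀ x : Fin n → ℝ,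
      fderiv ℝ (fun y => fderiv ℝ f y (Pi.single α 1)) x (Pi.single α 1) ≤ 0)
    (x' xbar : Fin n → ℝ) (xb xs : ℝ)
    (h1 : xs ≤ xb) (h2 : x' α < xs) :
    BShap (Function.update xbar α xb) x' f α / (xb - x' α) ≤
      BShap (Function.update xbar α xs) x' f α / (xs - x' α) := by
  have hcoal : ∀ S ∈ (Finset.univ.erase α).powerset, ∀ t : ℝ,
      (fun j => if j ∈ S then Function.update xbar α t j else x' j) =
          Function.update (fun j => if j ∈ S then xbar j else x' j) α (x' α) ∧
        (fun j => if j ∈ insert α S then Function.update xbar α t j else x' j) =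
          Function.update (fun j => if j ∈ S then xbar j else x' j) α t := by
    intro S hS t
    have hα : α ∉ S := fun h => Finset.notMem_erase α _ (Finset.mem_powerset.1 hS h)
    constructor <;> funext j <;> by_cases hj : j = α
    · subst hj; simp [hα]
    · simp [hj]
    · subst hj; simp
    · simp [hj]
  unfold BShap
  rw [Finset.sum_div, Finset.sum_div]
  refine Finset.sum_le_sum fun S hS => ?_
  rw [(hcoal S hS xb).1, (hcoal S hS xb).2, (hcoal S hS xs).1, (hcoal S hS xs).2,
    mul_div_assoc _ _ (xb - x' α), mul_div_assoc _ _ (xs - x' α)]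
  refine mul_le_mul_of_nonneg_left ?_ (by positivity)
  have hconc := concaveOn_comp_update (contDiff_infty.1 hsmooth 2) hd2
    (fun j => if j ∈ S then xbar j else x' j)
  have hsec := hconc.neg.secant_mono (Set.mem_univ (x' α)) (Set.mem_univ xs)
    (Set.mem_univ xb) h2.ne' (h2.trans_le h1).ne' h1
  simpa only [Pi.neg_apply, neg_sub_neg, ← neg_sub (f (Function.update _ α (x' α))), neg_div,
    neg_le_neg_iff] using hsec
end

section
/- Baseline Shapley preserves the reverse diminishing marginal axiom: let f : (Fin n → ℝ) → ℝ be smooth with ∂f/∂x_α ≤ 0 and ∂²f/∂x_α² ≥ 0 everywhere (reverse diminishing marginal effect in coordinate α). Then for any baseline x', any vector of other coordinates x̄_{¬α}, and any two values x̄_α ≥ x*_α > x'_α, one has BS_α((x̄_α, x̄_{¬α}), x', f) / (x̄_α − x'_α) ≥ BS_α((x*_α, x̄_{¬α}), x', f) / (x*_α − x'_α). -/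
open Finset

/-- The restriction of a smooth function to a coordinate line is convex when the pure second partial
derivative in that coordinate is nonnegative. -/
theorem convexOn_comp_update {ι : Type*} [Fintype ι] [DecidableEq ι] {f : (ι → ℝ) → ℝ}
    (hf : ContDiff ℝ 2 f) (i : ι)
    (hd2 : ∀ x : ι → ℝ, 0 ≤ fderiv ℝ (fun y => fderiv ℝ f y (Pi.single i 1)) x (Pi.single i 1))
    (z : ι → ℝ) : ConvexOn ℝ Set.univ fun t => f (Function.update z i t) := by
  have hasDeriv : ∀ {g : (ι → ℝ) → ℝ}, Differentiable ℝ g → ∀ t,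
      HasDerivAt (fun s => g (Function.update z i s))
        (fderiv ℝ g (Function.update z i t) (Pi.single i 1)) t := fun hg t =>
    (hg _).hasFDerivAt.comp_hasDerivAt t (hasDerivAt_update z i t)
  have hf1 : Differentiable ℝ f := hf.differentiable (by norm_num)
  have hf2 : Differentiable ℝ fun y => fderiv ℝ f y (Pi.single i 1) :=
    ((hf.fderiv_right (m := 1) (by norm_num)).clm_apply contDiff_const).differentiable
      (by norm_num)
  have hderiv : deriv (fun s => f (Function.update z i s)) =
      fun t => fderiv ℝ f (Function.update z i t) (Pi.single i 1) :=
    funext fun t => (hasDeriv hf1 t).deriv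
  refine Monotone.convexOn_univ_of_deriv (fun t => (hasDeriv hf1 t).differentiableAt) ?_
  rw [hderiv]
  refine monotone_of_deriv_nonneg (fun t => (hasDeriv hf2 t).differentiableAt) fun t => ?_
  rw [(hasDeriv hf2 t).deriv]
  exact hd2 _

/-- Baseline Shapley preserves the reverse diminishing marginal axiom. -/
theorem bshap_reverse_diminishing_marginal {n : ℕ}
    (f : (Fin n → ℝ) → ℝ) (α : Fin n)
    (hsmooth : ContDiff ℝ (⊤ : ℕ∞) f)
    (hd1 : ∀ x : Fin n → ℝ, fderiv ℝ f x (Pi.single α 1) ≤ 0)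
    (hd2 : ∀ x : Fin n → ℝ,
      0 ≤ fderiv ℝ (fun y => fderiv ℝ f y (Pi.single α 1)) x (Pi.single α 1))
    (x' xbar : Fin n → ℝ) (xb xs : ℝ)
    (h1 : xs ≤ xb) (h2 : x' α < xs) :
    BShap (Function.update xbar α xs) x' f α / (xs - x' α) ≤
      BShap (Function.update xbar α xb) x' f α / (xb - x' α) := by
  unfold BShap
  rw [Finset.sum_div, Finset.sum_div]
  refine Finset.sum_le_sum fun S hS => ?_
  have hα : α ∉ S := fun h => by simpa using Finset.mem_powerset.1 hS h
  let z : Fin n → ℝ := fun j => if j ∈ S then xbar j else x' j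
  have insert_eq : ∀ t, (fun j => if j ∈ insert α S then Function.update xbar α t j else x' j) =
      Function.update z α t := fun t => by
    ext j
    by_cases hj : j = α
    · subst hj; simp
    · simp [z, hj]
  have base_eq : ∀ t, (fun j => if j ∈ S then Function.update xbar α t j else x' j) =
      Function.update z α (x' α) := fun t => by
    ext j
    by_cases hj : j = α
    · subst hj; simp [hα]
    · simp [z, hj]
  simp only [insert_eq, base_eq, mul_div_assoc]
  refine mul_le_mul_of_nonneg_left ?_ (by positivity)
  exact (convexOn_comp_update (contDiff_infty.1 hsmooth 2) α hd2 z).secant_mono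
    (Set.mem_univ (x' α)) (Set.mem_univ xs) (Set.mem_univ xb) h2.ne' (h2.trans_le h1).ne' h1
end

section
/- Baseline Shapley preserves the generalized dummy axiom: let f : (Fin (n+1) → ℝ) → ℝ not depend on coordinate i (i.e. f(x) = f(update x i v) for all x and v), and let g : (Fin n → ℝ) → ℝ be the reduction of f omitting coordinate i, so that g(h(x)) = f(x) for all x, where h deletes the i-th coordinate. Then for every explicand x̄ and baseline x', BS_i(x̄, x', f) = 0, and for every coordinate j ≠ i, BS_j(x̄, x', f) = BS_{j'}(h(x̄), h(x'), g), where j' is the index of j in the reduced coordinate system. -/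
open Finset

/-- Weights of a coalition of size `s` without and with an extra player add up to its weight
in the game without that player. -/
theorem shapley_weight_add {n s : ℕ} (h : s < n) :
    ((s.factorial * (n + 1 - s - 1).factorial : ℝ) / ((n + 1).factorial : ℝ)) +
      (((s + 1).factorial * (n + 1 - (s + 1) - 1).factorial : ℝ) / ((n + 1).factorial : ℝ)) =
    (s.factorial * (n - s - 1).factorial : ℝ) / (n.factorial : ℝ) := by
  obtain ⟨k, rfl⟩ := Nat.exists_eq_add_of_lt h
  have h₁ : s + k + 1 + 1 - s - 1 = k + 1 := by omega
  have h₂ : s + k + 1 + 1 - (s + 1) - 1 = k := by omega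
  have h₃ : s + k + 1 - s - 1 = k := by omega
  rw [h₁, h₂, h₃, Nat.factorial_succ (s + k + 1), Nat.factorial_succ k, Nat.factorial_succ s]
  have hpos : ((s + k + 1).factorial : ℝ) ≠ 0 := by positivity
  have hsucc : ((s : ℝ) + k + 1 + 1) ≠ 0 := by positivity
  push_cast
  field_simp
  ring

theorem powerset_map_eq {α β : Type*} (e : α ↪ β) (s : Finset α) :
    (s.map e).powerset = s.powerset.map (Finset.mapEmbedding e).toEmbedding := by
  ext t
  simp [Finset.subset_map_iff, eq_comm]

theorem univ_erase_succAbove {n : ℕ} (i : Fin (n + 1)) (j : Fin n) :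
    (Finset.univ.erase (i.succAbove j) : Finset (Fin (n + 1))) =
      insert i ((Finset.univ.erase j).map i.succAboveEmb) := by
  ext k
  rcases i.eq_self_or_eq_succAbove k with rfl | ⟨l, rfl⟩ <;>
    simp [Fin.succAbove_ne, (Fin.succAbove_ne _ _).symm]

/-- Baseline Shapley preserves the generalized dummy axiom: if `f` does not depend on
coordinate `i` and `g` is the reduction of `f` omitting coordinate `i` (where
`x ∘ i.succAbove` deletes the `i`-th coordinate of `x`), then the attribution of `i`
vanishes and the attribution of every other coordinate `j = i.succAbove j'` agrees
with the attribution of `j'` for the reduced function `g`. -/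
theorem bshap_generalized_dummy {n : ℕ}
    (f : (Fin (n + 1) → ℝ) → ℝ) (i : Fin (n + 1))
    (hdummy : ∀ (x : Fin (n + 1) → ℝ) (v : ℝ), f (Function.update x i v) = f x)
    (g : (Fin n → ℝ) → ℝ)
    (hg : ∀ x : Fin (n + 1) → ℝ, g (x ∘ i.succAbove) = f x)
    (xbar x' : Fin (n + 1) → ℝ) :
    BShap xbar x' f i = 0 ∧
      ∀ j' : Fin n,
        BShap xbar x' f (i.succAbove j') =
          BShap (xbar ∘ i.succAbove) (x' ∘ i.succAbove) g j' := by
  constructor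
  · refine Finset.sum_eq_zero fun S _ => mul_eq_zero_of_right _ (sub_eq_zero.mpr ?_)
    rw [← hg, ← hg]
    congr 1
    ext k
    simp [Fin.succAbove_ne]
  · intro j
    have hi (T : Finset (Fin n)) : i ∉ T.map i.succAboveEmb := by
      simp [Fin.succAbove_ne]
    unfold BShap
    rw [univ_erase_succAbove, Finset.sum_powerset_insert (hi _), powerset_map_eq,
      Finset.sum_map, Finset.sum_map, ← Finset.sum_add_distrib]
    refine Finset.sum_congr rfl fun T hT => ?_
    have hcard : T.card < n := by
      have hjT : j ∉ T := fun h => by simpa using Finset.mem_powerset.mp hT h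
      simpa using Finset.card_lt_univ_of_notMem hjT
    simp only [RelEmbedding.coe_toEmbedding, Finset.mapEmbedding_apply,
      Finset.card_insert_of_notMem (hi T), Finset.card_map, ← hg]
    rw [← shapley_weight_add hcard, add_mul]
    congr 4 <;> ext k <;> simp [Fin.succAbove_ne]
end

section
/- Integrated Gradients preserves the diminishing marginal axiom: let f : (Fin n → ℝ) → ℝ be smooth with ∂f/∂x_α ≥ 0 and ∂²f/∂x_α² ≤ 0 everywhere. Then for any baseline x', any vector of other coordinates x̄_{¬α}, and any two values x̄_α ≥ x*_α > x'_α, one has IG_α((x̄_α, x̄_{¬α}), x', f) / (x̄_α − x'_α) ≤ IG_α((x*_α, x̄_{¬α}), x', f) / (x*_α − x'_α), where (v, x̄_{¬α}) denotes the explicand whose α-coordinate is v and whose other coordinates are x̄_{¬α}. -/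
open MeasureTheory

/-- Integrated Gradients attribution of coordinate `i`:
`IG_i(x̄, x', f) = (x̄_i − x'_i) · ∫_0^1 (∂f/∂x_i)(x' + t(x̄ − x')) dt`. -/
noncomputable def IG {n : ℕ} (xbar x' : Fin n → ℝ) (f : (Fin n → ℝ) → ℝ) (i : Fin n) : ℝ :=
  (xbar i - x' i) * ∫ t in (0:ℝ)..1, fderiv ℝ f (x' + t • (xbar - x')) (Pi.single i 1)

/-- A differentiable function whose derivative in the direction `v` is nonpositive everywhere is
antitone along every line in the direction `v`. -/
theorem antitone_comp_add_smul_of_fderiv_nonpos {E : Type*} [NormedAddCommGroup E]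
    [NormedSpace ℝ E] {g : E → ℝ} (hg : Differentiable ℝ g) {v : E}
    (hv : ∀ x, fderiv ℝ g x v ≤ 0) (x : E) : Antitone fun s : ℝ => g (x + s • v) := by
  have hderiv (s : ℝ) : HasDerivAt (fun s : ℝ => g (x + s • v)) (fderiv ℝ g (x + s • v) v) s := by
    have hline : HasDerivAt (fun s : ℝ => x + s • v) v s := by
      simpa using ((hasDerivAt_id s).smul_const v).const_add x
    exact (hg _).hasFDerivAt.comp_hasDerivAt s hline
  exact antitone_of_deriv_nonpos (fun s => (hderiv s).differentiableAt)
    fun s => (hderiv s).deriv ▸ hv _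

/-- For an explicand differing from the baseline in coordinate `i`, dividing the attribution by
that difference leaves the path average of the partial derivative. -/
theorem IG_update_div {n : ℕ} (xbar x' : Fin n → ℝ) (f : (Fin n → ℝ) → ℝ) (i : Fin n) {c : ℝ}
    (hc : x' i < c) :
    IG (Function.update xbar i c) x' f i / (c - x' i) =
      ∫ t in (0:ℝ)..1,
        fderiv ℝ f (x' + t • (Function.update xbar i c - x')) (Pi.single i 1) := by
  rw [IG, Function.update_self, mul_div_cancel_left₀ _ (sub_pos.2 hc).ne']

/-- Integrated Gradients preserves the diminishing marginal axiom. -/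
theorem ig_diminishing_marginal {n : ℕ}
    (f : (Fin n → ℝ) → ℝ) (α : Fin n)
    (hsmooth : ContDiff ℝ (⊤ : ℕ∞) f)
    (hd1 : ∀ x : Fin n → ℝ, 0 ≤ fderiv ℝ f x (Pi.single α 1))
    (hd2 : ∀ x : Fin n → ℝ,
      fderiv ℝ (fun y => fderiv ℝ f y (Pi.single α 1)) x (Pi.single α 1) ≤ 0)
    (x' xbar : Fin n → ℝ) (xb xs : ℝ)
    (h1 : xs ≤ xb) (h2 : x' α < xs) :
    IG (Function.update xbar α xb) x' f α / (xb - x' α) ≤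
      IG (Function.update xbar α xs) x' f α / (xs - x' α) := by
  have hg : ContDiff ℝ 1 fun y => fderiv ℝ f y (Pi.single α 1) :=
    ((contDiff_infty.1 hsmooth 2).fderiv_right one_add_one_eq_two.le).clm_apply contDiff_const
  have hint (c : ℝ) : IntervalIntegrable (fun t : ℝ =>
      fderiv ℝ f (x' + t • (Function.update xbar α c - x')) (Pi.single α 1)) volume 0 1 :=
    (hg.continuous.comp (by fun_prop :
      Continuous fun t : ℝ => x' + t • (Function.update xbar α c - x'))).intervalIntegrable 0 1
  rw [IG_update_div _ _ _ _ (h2.trans_le h1), IG_update_div _ _ _ _ h2]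
  refine intervalIntegral.integral_mono_on zero_le_one (hint xb) (hint xs) fun t ht => ?_
  have hshift : x' + t • (Function.update xbar α xb - x') =
      x' + t • (Function.update xbar α xs - x') + (t * (xb - xs)) • Pi.single α 1 := by
    ext j
    obtain rfl | hj := eq_or_ne j α
    · simp
      ring
    · simp [hj]
  have hanti := antitone_comp_add_smul_of_fderiv_nonpos (hg.differentiable one_ne_zero) hd2
    (x' + t • (Function.update xbar α xs - x')) (mul_nonneg ht.1 (sub_nonneg.2 h1))
  simpa only [hshift, zero_smul, add_zero] using hanti
end

section
/- Integrated Gradients preserves the reverse diminishing marginal axiom: let f : (Fin n → ℝ) → ℝ be smooth with ∂f/∂x_α ≤ 0 and ∂²f/∂x_α² ≥ 0 everywhere. Then for any baseline x', any vector of other coordinates x̄_{¬α}, and any two values x̄_α ≥ x*_α > x'_α, one has IG_α((x̄_α, x̄_{¬α}), x', f) / (x̄_α − x'_α) ≥ IG_α((x*_α, x̄_{¬α}), x', f) / (x*_α − x'_α). -/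
open MeasureTheory

/-- A differentiable function whose derivative in direction `v` is nonnegative everywhere is
monotone along every line with direction `v`. -/
theorem monotone_line_of_fderiv_nonneg {E : Type*} [NormedAddCommGroup E] [NormedSpace ℝ E]
    {g : E → ℝ} (hg : Differentiable ℝ g) {v : E} (hv : ∀ x, 0 ≤ fderiv ℝ g x v) (x : E) :
    Monotone fun s : ℝ => g (x + s • v) := by
  have hline : ∀ s : ℝ, HasDerivAt (fun s : ℝ => g (x + s • v)) (fderiv ℝ g (x + s • v) v) s := by
    intro s
    have hl : HasDerivAt (fun s : ℝ => x + s • v) v s := by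
      simpa using ((hasDerivAt_id s).smul_const v).const_add x
    exact (hg (x + s • v)).hasFDerivAt.comp_hasDerivAt s hl
  refine monotone_of_deriv_nonneg (fun s => (hline s).differentiableAt) fun s => ?_
  rw [(hline s).deriv]
  exact hv _

/-- Integrated Gradients preserves the reverse diminishing marginal axiom. -/
theorem ig_reverse_diminishing_marginal {n : ℕ}
    (f : (Fin n → ℝ) → ℝ) (α : Fin n)
    (hsmooth : ContDiff ℝ (⊤ : ℕ∞) f)
    (hd1 : ∀ x : Fin n → ℝ, fderiv ℝ f x (Pi.single α 1) ≤ 0)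
    (hd2 : ∀ x : Fin n → ℝ,
      0 ≤ fderiv ℝ (fun y => fderiv ℝ f y (Pi.single α 1)) x (Pi.single α 1))
    (x' xbar : Fin n → ℝ) (xb xs : ℝ)
    (h1 : xs ≤ xb) (h2 : x' α < xs) :
    IG (Function.update xbar α xs) x' f α / (xs - x' α) ≤
      IG (Function.update xbar α xb) x' f α / (xb - x' α) := by
  have hg : ContDiff ℝ 1 fun y => fderiv ℝ f y (Pi.single α 1) :=
    ((hsmooth.fderiv_right (m := (⊤ : ℕ∞)) le_rfl).of_le (by simp)).clm_apply contDiff_const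
  have hint : ∀ z : Fin n → ℝ, IntervalIntegrable
      (fun t : ℝ => fderiv ℝ f (x' + t • (z - x')) (Pi.single α 1)) volume 0 1 := fun z =>
    (hg.continuous.comp (by fun_prop : Continuous fun t : ℝ => x' + t • (z - x'))
      ).intervalIntegrable _ _
  simp only [IG, Function.update_self]
  rw [mul_div_cancel_left₀ _ (sub_pos.2 h2).ne',
    mul_div_cancel_left₀ _ (sub_pos.2 (h2.trans_le h1)).ne']
  refine intervalIntegral.integral_mono_on zero_le_one (hint _) (hint _) fun t ht => ?_
  have hpoint : x' + t • (Function.update xbar α xb - x') =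
      x' + t • (Function.update xbar α xs - x') + (t * (xb - xs)) • Pi.single α 1 := by
    ext j
    by_cases hj : j = α
    · subst hj
      simp
      ring
    · simp [hj]
  have hmono := monotone_line_of_fderiv_nonneg (hg.differentiable one_ne_zero) hd2
    (x' + t • (Function.update xbar α xs - x')) (mul_nonneg ht.1 (sub_nonneg.2 h1))
  rw [hpoint]
  simpa using hmono
end

section
/- Integrated Gradients preserves the increasing marginal axiom: let f : (Fin n → ℝ) → ℝ be smooth with ∂f/∂x_α ≥ 0 and ∂²f/∂x_α² ≥ 0 everywhere. Then for any baseline x', any vector of other coordinates x̄_{¬α}, and any two values x̄_α > x*_α > x'_α, one has IG_α((x̄_α, x̄_{¬α}), x', f) / (x̄_α − x'_α) ≥ IG_α((x*_α, x̄_{¬α}), x', f) / (x*_α − x'_α). -/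
open MeasureTheory

/-- A differentiable function whose derivative in the direction `v` is everywhere nonnegative
is monotone along every line in that direction. -/
theorem monotone_comp_line_of_fderiv_nonneg {E : Type*} [NormedAddCommGroup E] [NormedSpace ℝ E]
    {g : E → ℝ} {v : E} (hg : Differentiable ℝ g) (hv : ∀ x, 0 ≤ fderiv ℝ g x v) (x : E) :
    Monotone fun s : ℝ => g (x + s • v) := by
  have hline (s : ℝ) : HasDerivAt (fun s : ℝ => g (x + s • v)) (fderiv ℝ g (x + s • v) v) s := by
    have hs : HasDerivAt (fun s : ℝ => x + s • v) v s := by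
      simpa using ((hasDerivAt_id s).smul_const v).const_add x
    exact (hg _).hasFDerivAt.comp_hasDerivAt s hs
  exact monotone_of_hasDerivAt_nonneg hline fun s => hv _

/-- Integrated Gradients preserves the increasing marginal axiom. -/
theorem ig_increasing_marginal {n : ℕ}
    (f : (Fin n → ℝ) → ℝ) (α : Fin n)
    (hsmooth : ContDiff ℝ (⊤ : ℕ∞) f)
    (hd1 : ∀ x : Fin n → ℝ, 0 ≤ fderiv ℝ f x (Pi.single α 1))
    (hd2 : ∀ x : Fin n → ℝ,
      0 ≤ fderiv ℝ (fun y => fderiv ℝ f y (Pi.single α 1)) x (Pi.single α 1))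
    (x' xbar : Fin n → ℝ) (xb xs : ℝ)
    (h1 : xs < xb) (h2 : x' α < xs) :
    IG (Function.update xbar α xs) x' f α / (xs - x' α) ≤
      IG (Function.update xbar α xb) x' f α / (xb - x' α) := by
  have hg : ContDiff ℝ 1 fun y => fderiv ℝ f y (Pi.single α 1) :=
    (ContDiff.fderiv_right (n := 2) (contDiff_infty.1 hsmooth 2)
      one_add_one_eq_two.le).clm_apply contDiff_const
  have hint (c : ℝ) : IntervalIntegrable (fun t : ℝ =>
      fderiv ℝ f (x' + t • (Function.update xbar α c - x')) (Pi.single α 1)) volume 0 1 :=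
    (hg.continuous.comp (by fun_prop : Continuous fun t : ℝ =>
      x' + t • (Function.update xbar α c - x'))).intervalIntegrable 0 1
  simp only [IG, Function.update_self]
  rw [mul_div_cancel_left₀ _ (sub_pos.2 h2).ne',
    mul_div_cancel_left₀ _ (sub_pos.2 (h2.trans h1)).ne']
  refine intervalIntegral.integral_mono_on zero_le_one (hint xs) (hint xb) fun t ht => ?_
  have hmono := monotone_comp_line_of_fderiv_nonneg (hg.differentiable one_ne_zero) hd2
    (x' + t • (Function.update xbar α xs - x')) (mul_nonneg ht.1 (sub_pos.2 h1).le)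
  have hend : x' + t • (Function.update xbar α xb - x') =
      x' + t • (Function.update xbar α xs - x') + (t * (xb - xs)) • Pi.single α (1 : ℝ) := by
    ext j
    by_cases hj : j = α
    · subst hj
      simp
      ring
    · simp [hj]
  rw [hend]
  simpa using hmono
end

section
/- Integrated Gradients preserves the generalized dummy axiom: let f : (Fin (n+1) → ℝ) → ℝ be continuously differentiable and not depend on coordinate i (i.e. f(x) = f(update x i v) for all x and v), and let g : (Fin n → ℝ) → ℝ be the reduction of f omitting coordinate i, so that g(h(x)) = f(x) for all x, where h deletes the i-th coordinate. Then for every explicand x̄ and baseline x', IG_i(x̄, x', f) = 0, and for every coordinate j ≠ i, IG_j(x̄, x', f) = IG_{j'}(h(x̄), h(x'), g), where j' is the index of j in the reduced coordinate system. -/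
open MeasureTheory

/-- The continuous linear map deleting the `i`-th coordinate. -/
noncomputable def deleteCoord {n : ℕ} (i : Fin (n + 1)) :
    (Fin (n + 1) → ℝ) →L[ℝ] (Fin n → ℝ) :=
  ContinuousLinearMap.pi fun j => ContinuousLinearMap.proj (i.succAbove j)

theorem deleteCoord_apply {n : ℕ} (i : Fin (n + 1)) (x : Fin (n + 1) → ℝ) :
    deleteCoord i x = x ∘ i.succAbove := rfl

theorem deleteCoord_single_self {n : ℕ} (i : Fin (n + 1)) (c : ℝ) :
    deleteCoord i (Pi.single i c) = 0 := by
  ext k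
  simp [deleteCoord_apply]

theorem deleteCoord_single_succAbove {n : ℕ} (i : Fin (n + 1)) (j : Fin n) (c : ℝ) :
    deleteCoord i (Pi.single (i.succAbove j) c) = Pi.single j c := by
  ext k
  simp [deleteCoord_apply, Pi.single_apply]

theorem differentiable_insertNth {n : ℕ} (i : Fin (n + 1)) (c : ℝ) :
    Differentiable ℝ fun y : Fin n → ℝ => (i.insertNth c y : Fin (n + 1) → ℝ) := by
  refine differentiable_pi.2 fun k => ?_
  induction k using i.succAboveCases with
  | x => simp
  | p j => simpa using differentiable_apply j

/-- A reduction of a differentiable function omitting coordinate `i` is differentiable. -/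
theorem differentiable_of_comp_succAbove {n : ℕ} {f : (Fin (n + 1) → ℝ) → ℝ}
    {g : (Fin n → ℝ) → ℝ} (i : Fin (n + 1)) (hf : Differentiable ℝ f)
    (hg : ∀ x : Fin (n + 1) → ℝ, g (x ∘ i.succAbove) = f x) : Differentiable ℝ g := by
  have hgf : g = fun y => f (i.insertNth 0 y) := by
    funext y
    rw [← hg]
    congr 1
    ext j
    simp
  rw [hgf]
  exact hf.comp (differentiable_insertNth i 0)

theorem fderiv_eq_fderiv_deleteCoord {n : ℕ} {f : (Fin (n + 1) → ℝ) → ℝ}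
    {g : (Fin n → ℝ) → ℝ} (i : Fin (n + 1)) (hf : Differentiable ℝ f)
    (hg : ∀ x : Fin (n + 1) → ℝ, g (x ∘ i.succAbove) = f x) (x v : Fin (n + 1) → ℝ) :
    fderiv ℝ f x v = fderiv ℝ g (deleteCoord i x) (deleteCoord i v) := by
  have hfg : f = g ∘ deleteCoord i := funext fun x => (hg x).symm
  have hd := (differentiable_of_comp_succAbove i hf hg (deleteCoord i x)).hasFDerivAt
  rw [hfg, (hd.comp x (deleteCoord i).hasFDerivAt).fderiv]
  rfl

/-- Integrated Gradients preserves the generalized dummy axiom: if `f` is continuously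
differentiable and does not depend on coordinate `i`, and `g` is the reduction of `f`
omitting coordinate `i` (where `x ∘ i.succAbove` deletes the `i`-th coordinate of `x`),
then the attribution of `i` vanishes and the attribution of every other coordinate
`j = i.succAbove j'` agrees with the attribution of `j'` for the reduced function `g`. -/
theorem ig_generalized_dummy {n : ℕ}
    (f : (Fin (n + 1) → ℝ) → ℝ) (i : Fin (n + 1))
    (hf : ContDiff ℝ 1 f)
    (hdummy : ∀ (x : Fin (n + 1) → ℝ) (v : ℝ), f (Function.update x i v) = f x)
    (g : (Fin n → ℝ) → ℝ)
    (hg : ∀ x : Fin (n + 1) → ℝ, g (x ∘ i.succAbove) = f x)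
    (xbar x' : Fin (n + 1) → ℝ) :
    IG xbar x' f i = 0 ∧
      ∀ j' : Fin n,
        IG xbar x' f (i.succAbove j') =
          IG (xbar ∘ i.succAbove) (x' ∘ i.succAbove) g j' := by
  have hd : Differentiable ℝ f := hf.differentiable one_ne_zero
  constructor
  · simp [IG, fderiv_eq_fderiv_deleteCoord i hd hg, deleteCoord_single_self]
  · intro j'
    simp only [IG, fderiv_eq_fderiv_deleteCoord i hd hg, deleteCoord_single_succAbove,
      map_add, map_smul, map_sub]
    rfl
end

section
/- Integrated Gradients preserves first-order monotonic dominance: let f : ℝ × (Fin p → ℝ) × (Fin q → ℝ) → ℝ and g : ℝ × (Fin p → ℝ) × (Fin r → ℝ) → ℝ be continuously differentiable, and suppose that for all a ∈ ℝ, all shared coordinates b ∈ (Fin p → ℝ), and all u ∈ (Fin q → ℝ), w ∈ (Fin r → ℝ), one has ∂f/∂a(a, b, u) ≥ ∂g/∂a(a, b, w). Then for explicands x̄ = (ā, b̄, ū) and ȳ = (ā, b̄, w̄) with the same first coordinate and shared coordinates, and baselines x' = (a', b', u') and y' = (a', b', w') with the same first coordinate and shared coordinates, where ā ≥ a', the Integrated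 Gradients attribution of the first coordinate satisfies IG_a(x̄, x', f) ≥ IG_a(ȳ, y', g). -/
open MeasureTheory

/-- A directional derivative of a `C¹` function is integrable along a segment. -/
theorem intervalIntegrable_fderiv_segment {E : Type*} [NormedAddCommGroup E] [NormedSpace ℝ E]
    {F : E → ℝ} (hF : ContDiff ℝ 1 F) (x y v : E) :
    IntervalIntegrable (fun t : ℝ => fderiv ℝ F (x + t • y) v) volume 0 1 := by
  have hF' : Continuous (fderiv ℝ F) := hF.continuous_fderiv one_ne_zero
  exact Continuous.intervalIntegrable (by fun_prop) 0 1

/-- Integrated Gradients preserves first-order monotonic dominance: if for all points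
sharing the first coordinate `a` and the shared block `b` one has
`∂f/∂a (a, b, u) ≥ ∂g/∂a (a, b, w)`, then for explicands and baselines sharing the first
coordinate and the shared block (with `ā ≥ a'`), the Integrated Gradients attribution of
the first coordinate for `f` is at least that for `g`.  Here the attribution of the
first coordinate is `(ā − a') · ∫_0^1 ∂F/∂a (x' + t(x̄ − x')) dt` with
`∂F/∂a (x) = fderiv ℝ F x (1, 0, 0)`. -/
theorem ig_first_order_monotonic_dominance {p q r : ℕ}
    (f : ℝ × (Fin p → ℝ) × (Fin q → ℝ) → ℝ)
    (g : ℝ × (Fin p → ℝ) × (Fin r → ℝ) → ℝ)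
    (hf : ContDiff ℝ 1 f) (hg : ContDiff ℝ 1 g)
    (hdom : ∀ (a : ℝ) (b : Fin p → ℝ) (u : Fin q → ℝ) (w : Fin r → ℝ),
      fderiv ℝ g (a, b, w) (1, 0, 0) ≤ fderiv ℝ f (a, b, u) (1, 0, 0))
    (abar a' : ℝ) (bbar b' : Fin p → ℝ) (ubar u' : Fin q → ℝ) (wbar w' : Fin r → ℝ)
    (ha : a' ≤ abar) :
    (abar - a') *
        ∫ t in (0:ℝ)..1,
          fderiv ℝ g ((a', b', w') + t • ((abar, bbar, wbar) - (a', b', w'))) (1, 0, 0) ≤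
      (abar - a') *
        ∫ t in (0:ℝ)..1,
          fderiv ℝ f ((a', b', u') + t • ((abar, bbar, ubar) - (a', b', u'))) (1, 0, 0) := by
  refine mul_le_mul_of_nonneg_left ?_ (sub_nonneg.mpr ha)
  refine intervalIntegral.integral_mono_on zero_le_one
    (intervalIntegrable_fderiv_segment hg _ _ _) (intervalIntegrable_fderiv_segment hf _ _ _) ?_
  intro t _
  exact hdom (a' + t • (abar - a')) (b' + t • (bbar - b')) (u' + t • (ubar - u'))
    (w' + t • (wbar - w'))
end

section
/- If f has the increasing marginal effect in coordinate α, then Integrated Gradients preserves demand individual monotonicity: let f : (Fin n → ℝ) → ℝ be smooth with ∂f/∂x_α ≥ 0 and ∂²f/∂x_α² ≥ 0 everywhere, let x̄ be an explicand and x' a baseline with x' ≤ x̄ componentwise, and let x* = update x̄ α (x̄_α + c) for some c > 0. Then IG_α(x*, x', f) ≥ IG_α(x̄, x', f). -/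
open MeasureTheory

/-- A differentiable function whose derivative in the direction `v` is everywhere nonnegative
does not decrease when moving along `v`. -/
theorem le_apply_add_smul_of_fderiv_nonneg {E : Type*} [NormedAddCommGroup E] [NormedSpace ℝ E]
    {g : E → ℝ} (hg : Differentiable ℝ g) {v : E} (hv : ∀ x, 0 ≤ fderiv ℝ g x v)
    (x : E) {s : ℝ} (hs : 0 ≤ s) : g x ≤ g (x + s • v) := by
  have hderiv (r : ℝ) : HasDerivAt (fun r : ℝ => g (x + r • v)) (fderiv ℝ g (x + r • v) v) r := by
    have hline : HasDerivAt (fun r : ℝ => x + r • v) v r := by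
      simpa using ((hasDerivAt_id r).smul_const v).const_add x
    exact (hg _).hasFDerivAt.comp_hasDerivAt r hline
  have hmono : Monotone (fun r : ℝ => g (x + r • v)) :=
    monotone_of_deriv_nonneg (fun r => (hderiv r).differentiableAt)
      (fun r => by rw [(hderiv r).deriv]; exact hv _)
  simpa using hmono hs

/-- If `f` has the increasing marginal effect in coordinate `α`, then Integrated
Gradients preserves demand individual monotonicity in coordinate `α`. -/
theorem ig_demand_individual_monotonicity_of_ime {n : ℕ}
    (f : (Fin n → ℝ) → ℝ) (α : Fin n)
    (hsmooth : ContDiff ℝ (⊤ : ℕ∞) f)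
    (hd1 : ∀ x : Fin n → ℝ, 0 ≤ fderiv ℝ f x (Pi.single α 1))
    (hd2 : ∀ x : Fin n → ℝ,
      0 ≤ fderiv ℝ (fun y => fderiv ℝ f y (Pi.single α 1)) x (Pi.single α 1))
    (xbar x' : Fin n → ℝ) (hx : ∀ j, x' j ≤ xbar j)
    (c : ℝ) (hc : 0 < c)
    (xstar : Fin n → ℝ) (hstar : xstar = Function.update xbar α (xbar α + c)) :
    IG xbar x' f α ≤ IG xstar x' f α := by
  have hdiff : Differentiable ℝ (fun y => fderiv ℝ f y (Pi.single α 1)) :=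
    ((hsmooth.fderiv_right (m := (⊤ : ℕ∞)) (by simp)).clm_apply
      contDiff_const).differentiable (by simp)
  have hint (z : Fin n → ℝ) : IntervalIntegrable
      (fun t : ℝ => fderiv ℝ f (x' + t • z) (Pi.single α 1)) volume 0 1 :=
    (hdiff.continuous.comp (f := fun t : ℝ => x' + t • z) (by fun_prop)).intervalIntegrable 0 1
  have hshift : xstar = xbar + c • Pi.single α 1 := by
    subst hstar
    ext j
    by_cases hj : j = α
    · subst hj
      simp
    · simp [hj]
  have hcoord : xstar α = xbar α + c := by simp [hstar]
  unfold IG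
  have hα := hx α
  refine mul_le_mul (by linarith) ?_
    (intervalIntegral.integral_nonneg zero_le_one fun t _ => hd1 _) (by linarith)
  refine intervalIntegral.integral_mono_on zero_le_one (hint _) (hint _) fun t ht => ?_
  have hpath : x' + t • (xstar - x') = x' + t • (xbar - x') + (t * c) • Pi.single α 1 := by
    rw [hshift]
    module
  rw [hpath]
  exact le_apply_add_smul_of_fderiv_nonneg hdiff hd2 _ (mul_nonneg ht.1 hc.le)
end

section
/- Any baseline attribution method that is linear and preserves average individual monotonicity preserves first-order monotonic dominance (common-feature-space form): let A : (Fin n → ℝ) → (Fin n → ℝ) → (((Fin n → ℝ) → ℝ)) → (Fin n → ℝ) be a baseline attribution method such that (i) A is linear in the function argument, i.e. A(x̄, x', f − g) = A(x̄, x', f) − A(x̄, x', g) for all f, g, and (ii) A satisfies average individual monotonicity, i.e. whenever h is individually monotonic (increasing) in coordinate α and x' ≤ x̄ componentwise, A(x̄, x', h)_α ≥ 0. Then for any continuously differentiable f, g : (Fin n → ℝ) → ℝ with ∂f/∂x_α(x) ≥ ∂g/∂x_α(x) for every x, and any x' ≤ x̄ componentwise, one has A(x̄, x', f)_α ≥ A(x̄,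 x', g)_α. -/
/-- A differentiable function on `ι → ℝ` whose partial derivative in the coordinate `i` is
nonnegative everywhere is monotone in that coordinate. -/
theorem monotone_comp_update_of_fderiv_single_nonneg {ι : Type*} [Fintype ι] [DecidableEq ι]
    {h : (ι → ℝ) → ℝ} {i : ι} (hh : Differentiable ℝ h)
    (hnonneg : ∀ x, 0 ≤ fderiv ℝ h x (Pi.single i 1)) (x : ι → ℝ) :
    Monotone fun v => h (Function.update x i v) := by
  have hderiv (v : ℝ) : HasDerivAt (fun v => h (Function.update x i v))
      (fderiv ℝ h (Function.update x i v) (Pi.single i 1)) v :=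
    (hh _).hasFDerivAt.comp_hasDerivAt v (hasDerivAt_update x i v)
  exact monotone_of_hasDerivAt_nonneg hderiv fun v => hnonneg _


/-- Any baseline attribution method that is linear in the function argument and
preserves average individual monotonicity also preserves first-order monotonic
dominance (common-feature-space form). -/
theorem bam_linear_aim_implies_fmd {n : ℕ}
    (A : (Fin n → ℝ) → (Fin n → ℝ) → ((Fin n → ℝ) → ℝ) → (Fin n → ℝ))
    (hlin : ∀ (xbar x' : Fin n → ℝ) (f g : (Fin n → ℝ) → ℝ),
      A xbar x' (f - g) = A xbar x' f - A xbar x' g)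
    (haim : ∀ (h : (Fin n → ℝ) → ℝ) (α : Fin n) (xbar x' : Fin n → ℝ),
      (∀ (x : Fin n → ℝ) (v : ℝ), x α ≤ v → h x ≤ h (Function.update x α v)) →
      (∀ j, x' j ≤ xbar j) → 0 ≤ A xbar x' h α)
    (f g : (Fin n → ℝ) → ℝ) (α : Fin n)
    (hf : ContDiff ℝ 1 f) (hg : ContDiff ℝ 1 g)
    (hdom : ∀ x : Fin n → ℝ, fderiv ℝ g x (Pi.single α 1) ≤ fderiv ℝ f x (Pi.single α 1))
    (xbar x' : Fin n → ℝ) (hx : ∀ j, x' j ≤ xbar j) :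
    A xbar x' g α ≤ A xbar x' f α := by
  have hf' : Differentiable ℝ f := hf.differentiable one_ne_zero
  have hg' : Differentiable ℝ g := hg.differentiable one_ne_zero
  have hnonneg (x : Fin n → ℝ) : 0 ≤ fderiv ℝ (f - g) x (Pi.single α 1) := by
    rw [fderiv_sub (hf' x) (hg' x)]
    exact sub_nonneg.2 (hdom x)
  have hmono (x : Fin n → ℝ) (v : ℝ) (hv : x α ≤ v) :
      (f - g) x ≤ (f - g) (Function.update x α v) := by
    simpa only [Function.update_eq_self] using
      monotone_comp_update_of_fderiv_single_nonneg (hf'.sub hg') hnonneg x hv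
  have hdiff := haim (f - g) α xbar x' hmono hx
  rw [hlin] at hdiff
  exact sub_nonneg.1 hdiff
end

section
/- Closed form of the Integrated Gradients attribution of the interest rate for a zero-coupon bond: fix T > 0 and let f : ℝ × ℝ → ℝ be f(c, r) = c · exp(−r·T) (bond price with principal c and interest rate r). For the baseline (0, 0) and explicand (c̄, r̄) with c̄ > 0 and r̄ > 0, the Integrated Gradients attribution of the r-coordinate equals IG_r = r̄ · ∫_0^1 (∂f/∂r)(t·c̄, t·r̄) dt = c̄ · ( exp(−r̄·T) + exp(−r̄·T)/(r̄·T) − 1/(r̄·T) ). -/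
open MeasureTheory

/-- The partial derivative in the interest rate of the zero-coupon bond price. -/
theorem fderiv_bond_price_rate (T : ℝ) (x : ℝ × ℝ) :
    fderiv ℝ (fun p : ℝ × ℝ => p.1 * Real.exp (-p.2 * T)) x (0, 1) =
      -T * x.1 * Real.exp (-x.2 * T) := by
  have h : HasFDerivAt (fun p : ℝ × ℝ => p.1 * Real.exp (-p.2 * T)) _ x :=
    hasFDerivAt_fst.mul ((hasFDerivAt_snd.neg.mul_const T).exp)
  rw [h.fderiv]
  simp
  ring

theorem integral_mul_exp_neg_mul {a : ℝ} (ha : a ≠ 0) :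
    ∫ t in (0 : ℝ)..1, t * Real.exp (-(a * t)) =
      1 / a ^ 2 - (1 / a + 1 / a ^ 2) * Real.exp (-a) := by
  have h : ∀ t ∈ Set.uIcc (0 : ℝ) 1,
      HasDerivAt (fun t => -((t / a + 1 / a ^ 2) * Real.exp (-(a * t))))
        (t * Real.exp (-(a * t))) t := by
    intro t _
    have h₁ : HasDerivAt (fun t : ℝ => t / a + 1 / a ^ 2) (1 / a) t :=
      ((hasDerivAt_id t).div_const a).add_const _
    have h₂ : HasDerivAt (fun t : ℝ => Real.exp (-(a * t)))
        (Real.exp (-(a * t)) * -(a * 1)) t :=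
      ((hasDerivAt_id t).const_mul a).neg.exp
    refine (h₁.mul h₂).neg.congr_deriv ?_
    field_simp
    ring
  rw [intervalIntegral.integral_eq_sub_of_hasDerivAt h
    (Continuous.intervalIntegrable (by fun_prop) _ _)]
  simp
  ring

/-- Closed form of the Integrated Gradients attribution of the interest rate for a
zero-coupon bond `f(c, r) = c · exp(−r·T)`, with baseline `(0, 0)` and explicand
`(c̄, r̄)`: it equals `c̄ · (exp(−r̄T) + exp(−r̄T)/(r̄T) − 1/(r̄T))`.  The attribution
of the `r`-coordinate is `(r̄ − 0) · ∫_0^1 (∂f/∂r)((0,0) + t·((c̄,r̄) − (0,0))) dt`,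
where `∂f/∂r (x) = fderiv ℝ f x (0, 1)`. -/
theorem bond_ig_closed_form (T : ℝ) (hT : 0 < T)
    (f : ℝ × ℝ → ℝ) (hf : f = fun p => p.1 * Real.exp (-p.2 * T))
    (cbar rbar : ℝ) (hc : 0 < cbar) (hr : 0 < rbar) :
    (rbar - 0) *
        ∫ t in (0:ℝ)..1, fderiv ℝ f ((0, 0) + t • ((cbar, rbar) - (0, 0))) (0, 1) =
      cbar * (Real.exp (-rbar * T) + Real.exp (-rbar * T) / (rbar * T) - 1 / (rbar * T)) := by
  subst hf
  have h : ∀ t : ℝ,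
      fderiv ℝ (fun p : ℝ × ℝ => p.1 * Real.exp (-p.2 * T))
          ((0, 0) + t • ((cbar, rbar) - (0, 0))) (0, 1) =
        -T * cbar * (t * Real.exp (-(rbar * T * t))) := by
    intro t
    rw [fderiv_bond_price_rate]
    simp only [Prod.fst_add, Prod.snd_add, Prod.smul_fst, Prod.smul_snd, Prod.fst_sub,
      Prod.snd_sub, smul_eq_mul, zero_add, sub_zero]
    rw [show -(t * rbar) * T = -(rbar * T * t) by ring]
    ring
  simp_rw [h]
  rw [intervalIntegral.integral_const_mul, integral_mul_exp_neg_mul (by positivity),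
    ← neg_mul]
  field_simp
  ring
end

section
/- Integrated Gradients violates demand individual monotonicity: fix T > 0 and c̄ > 0, and let f : ℝ × ℝ → ℝ be f(c, r) = c·exp(−r·T), which is monotonically decreasing in r. Then there exist 0 < r₁ < r₂ such that the Integrated Gradients attribution of the r-coordinate with baseline (0, 0) satisfies IG_r((c̄, r₂), (0,0), f) > IG_r((c̄, r₁), (0,0), f); that is, increasing the monotone feature r does not decrease (make more negative) its attribution. -/
open MeasureTheory

theorem fderiv_mul_exp_neg_mul_apply (T : ℝ) (p : ℝ × ℝ) :
    fderiv ℝ (fun p : ℝ × ℝ => p.1 * Real.exp (-p.2 * T)) p (0, 1) =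
      -(T * p.1 * Real.exp (-p.2 * T)) := by
  have h₁ : HasFDerivAt (fun p : ℝ × ℝ => p.1) (ContinuousLinearMap.fst ℝ ℝ ℝ) p :=
    hasFDerivAt_fst
  have h₂ : HasFDerivAt (fun p : ℝ × ℝ => p.2) (ContinuousLinearMap.snd ℝ ℝ ℝ) p :=
    hasFDerivAt_snd
  have h : HasFDerivAt (fun p : ℝ × ℝ => p.1 * Real.exp (-p.2 * T)) _ p :=
    h₁.mul (h₂.neg.mul_const T).exp
  rw [h.fderiv]
  simp
  ring

/-- The closed form of the attribution of the rate. -/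
theorem mul_integral_fderiv_mul_exp_neg_mul (T c r : ℝ) (hT : T ≠ 0) (hr : r ≠ 0) :
    r * (∫ t in (0:ℝ)..1, fderiv ℝ (fun p : ℝ × ℝ => p.1 * Real.exp (-p.2 * T))
        ((0, 0) + t • ((c, r) - (0, 0))) (0, 1)) =
      c * (Real.exp (-(r * T)) + Real.exp (-(r * T)) / (r * T) - 1 / (r * T)) := by
  have hderiv : ∀ t ∈ Set.uIcc (0:ℝ) 1,
      HasDerivAt
        (fun t => c * (t * Real.exp (-(t * (r * T))) + Real.exp (-(t * (r * T))) / (r * T)))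
        (r * -(T * (t * c) * Real.exp (-(t * r) * T))) t := by
    intro t _
    have he : HasDerivAt (fun t => Real.exp (-(t * (r * T))))
        (Real.exp (-(t * (r * T))) * -(1 * (r * T))) t :=
      ((hasDerivAt_id t).mul_const (r * T)).neg.exp
    refine ((((hasDerivAt_id t).mul he).add (he.div_const (r * T))).const_mul c).congr_deriv ?_
    rw [show -(t * r) * T = -(t * (r * T)) by ring]
    simp only [id]
    field_simp
    ring
  rw [← intervalIntegral.integral_const_mul]
  simp only [fderiv_mul_exp_neg_mul_apply, Prod.mk_sub_mk, sub_zero, Prod.smul_mk, smul_eq_mul,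
    Prod.mk_add_mk, zero_add]
  rw [intervalIntegral.integral_eq_sub_of_hasDerivAt hderiv
    (Continuous.intervalIntegrable (by fun_prop) _ _)]
  simp
  ring

/-- Integrated Gradients violates demand individual monotonicity for the zero-coupon
bond `f(c, r) = c · exp(−r·T)` (which is monotonically decreasing in `r`): there exist
interest rates `0 < r₁ < r₂` for which increasing the monotone feature `r` strictly
increases its Integrated Gradients attribution (with baseline `(0, 0)`), rather than
decreasing it.  The attribution of the `r`-coordinate at explicand `(c̄, r)` is
`(r − 0) · ∫_0^1 (∂f/∂r)((0,0) + t·((c̄,r) − (0,0))) dt` with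
`∂f/∂r (x) = fderiv ℝ f x (0, 1)`. -/
theorem ig_violates_demand_individual_monotonicity (T : ℝ) (hT : 0 < T)
    (cbar : ℝ) (hc : 0 < cbar)
    (f : ℝ × ℝ → ℝ) (hf : f = fun p => p.1 * Real.exp (-p.2 * T)) :
    ∃ r₁ r₂ : ℝ, 0 < r₁ ∧ r₁ < r₂ ∧
      (r₁ - 0) *
          (∫ t in (0:ℝ)..1, fderiv ℝ f ((0, 0) + t • ((cbar, r₁) - (0, 0))) (0, 1)) <
        (r₂ - 0) *
          (∫ t in (0:ℝ)..1, fderiv ℝ f ((0, 0) + t • ((cbar, r₂) - (0, 0))) (0, 1)) := by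
  subst hf
  refine ⟨2 / T, 4 / T, by positivity, by gcongr; norm_num, ?_⟩
  rw [sub_zero, sub_zero, mul_integral_fderiv_mul_exp_neg_mul T cbar _ hT.ne' (by positivity),
    mul_integral_fderiv_mul_exp_neg_mul T cbar _ hT.ne' (by positivity),
    div_mul_cancel₀ _ hT.ne', div_mul_cancel₀ _ hT.ne']
  have h₂ : Real.exp (-2) < 1 / 6 := by
    have h : Real.exp (-2) = (Real.exp 1 * Real.exp 1)⁻¹ := by
      rw [← Real.exp_add, ← Real.exp_neg]
      norm_num
    rw [h, one_div]
    gcongr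
    nlinarith [Real.exp_one_gt_d9]
  have h₄ : 0 < Real.exp (-4) := Real.exp_pos _
  gcongr cbar * ?_
  linarith
end
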